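/- Let q ≥ 1 and α ∈ ℝ. (a) If n ∈ ℕ₀ and (s_j)_{j=0}^{2n+1} ∈ K≥,e_{α,q,2n+1}, then T_{q,n}*(D_n) ⊆ D_{α▷n} ⊆ D_n, and both ker H_n ⊕ D_n = ℂ^{(n+1)q} and ker H_{α▷n} ⊕ D_{α▷n} = ℂ^{(n+1)q} are direct sum decompositions. (b) If n ∈ ℕ and (s_j)_{j=0}^{2n} ∈ K≥,e_{α,q,2n}, then 𝔙_{q,n}*(D_n) ⊆ D_{α▷(n−1)} and V_{q,n}(D_{α▷(n−1)}) ⊆ D_n, and moreover ker H_n ⊕ D_n = ℂ^{(n+1)q} and ker H_{α▷(n−1)} ⊕ D_{α▷(n−1)} = ℂ^{nq}. -/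

import Mathlib

open Matrix ComplexConjugate
open scoped ComplexOrder

noncomputable section

/-- The block Hankel matrix `H_n = [s_{j+k}]_{j,k=0}^n`. -/
def hank (q n : ℕ) (s : ℕ → Matrix (Fin q) (Fin q) ℂ) :
    Matrix (Fin (n + 1) × Fin q) (Fin (n + 1) × Fin q) ℂ :=
  Matrix.of fun j k => s (j.1.val + k.1.val) j.2 k.2

/-- The right-sided `α`-shifted sequence `s_{α▷j} = -α·s_j + s_{j+1}`. -/
def sShift {q : ℕ} (α : ℝ) (s : ℕ → Matrix (Fin q) (Fin q) ℂ) :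
    ℕ → Matrix (Fin q) (Fin q) ℂ :=
  fun j => (-(α : ℂ)) • s j + s (j + 1)

/-- The block shift `T_{q,n} = [δ_{j,k+1}·I_q]_{j,k=0}^n`. -/
def bshift (q n : ℕ) : Matrix (Fin (n + 1) × Fin q) (Fin (n + 1) × Fin q) ℂ :=
  Matrix.of fun j k => if j.1.val = k.1.val + 1 ∧ j.2 = k.2 then (1 : ℂ) else 0

/-- `v_{q,n} = col(δ_{j,0}·I_q)_{j=0}^n`. -/
def vq (q n : ℕ) : Matrix (Fin (n + 1) × Fin q) (Fin q) ℂ :=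
  Matrix.of fun j b => if j.1.val = 0 ∧ j.2 = b then (1 : ℂ) else 0

/-- `u_n = -col(s_{j-1})_{j=0}^n` with `s_{-1} = 0`. -/
def uq (q n : ℕ) (s : ℕ → Matrix (Fin q) (Fin q) ℂ) :
    Matrix (Fin (n + 1) × Fin q) (Fin q) ℂ :=
  Matrix.of fun j b => if j.1.val = 0 then 0 else -s (j.1.val - 1) j.2 b

/-- `y_{0,n} = col(s_j)_{j=0}^n`. -/
def yq (q n : ℕ) (s : ℕ → Matrix (Fin q) (Fin q) ℂ) :
    Matrix (Fin (n + 1) × Fin q) (Fin q) ℂ :=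
  Matrix.of fun j b => s j.1.val j.2 b

/-- `R_T(z) = (I - z·T_{q,n})⁻¹`. -/
def RT (q n : ℕ) (z : ℂ) : Matrix (Fin (n + 1) × Fin q) (Fin (n + 1) × Fin q) ℂ :=
  (1 - z • bshift q n)⁻¹

/-- `R_{T*}(z) = (I - z·T_{q,n}*)⁻¹`. -/
def RTs (q n : ℕ) (z : ℂ) : Matrix (Fin (n + 1) × Fin q) (Fin (n + 1) × Fin q) ℂ :=
  (1 - z • (bshift q n)ᴴ)⁻¹

open scoped Classical in
/-- The Moore–Penrose inverse of a complex matrix (it exists and is unique,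
so the `dite` below always takes its first branch and picks it out). -/
def mp {m n : Type*} [Fintype m] [Fintype n] (A : Matrix m n ℂ) : Matrix n m ℂ :=
  if h : ∃ X : Matrix n m ℂ,
      A * X * A = A ∧ X * A * X = X ∧ (A * X)ᴴ = A * X ∧ (X * A)ᴴ = X * A
  then h.choose else 0

/-- The Schur complements `L_0 = s_0` and
`L_j = s_{2j} - z_{j,2j-1}·(H_{j-1})^†·y_{j,2j-1}` for `j ≥ 1`. -/
def LS (q : ℕ) (s : ℕ → Matrix (Fin q) (Fin q) ℂ) : ℕ → Matrix (Fin q) (Fin q) ℂ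
  | 0 => s 0
  | n + 1 =>
      s (2 * (n + 1)) -
        (Matrix.of fun (a : Fin q) (j : Fin (n + 1) × Fin q) => s ((n + 1) + j.1.val) a j.2) *
          mp (hank q n s) *
          (Matrix.of fun (j : Fin (n + 1) × Fin q) (b : Fin q) => s ((n + 1) + j.1.val) j.2 b)

/-- The block diagonal matrix `diag(L_0, …, L_n)`. -/
def Ldiag (q n : ℕ) (s : ℕ → Matrix (Fin q) (Fin q) ℂ) :
    Matrix (Fin (n + 1) × Fin q) (Fin (n + 1) × Fin q) ℂ :=
  Matrix.of fun j k => if j.1 = k.1 then LS q s j.1.val j.2 k.2 else 0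

/-- The subspace `D_n = range(diag(L_0, …, L_n)) ⊆ ℂ^{(n+1)q}`. -/
def Dsub (q n : ℕ) (s : ℕ → Matrix (Fin q) (Fin q) ℂ) :
    Submodule ℂ (Fin (n + 1) × Fin q → ℂ) :=
  LinearMap.range (Matrix.mulVecLin (Ldiag q n s))

/-- `V_{q,n+1} = [δ_{j,k}·I_q]`, embedding `ℂ^{(n+1)q}` into the first `n+1` block
components of `ℂ^{(n+2)q}` (defined here with `n+1` block columns). -/
def embV (q n : ℕ) : Matrix (Fin (n + 1) × Fin q) (Fin n × Fin q) ℂ :=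
  Matrix.of fun j k => if j.1.val = k.1.val ∧ j.2 = k.2 then (1 : ℂ) else 0

/-- `𝔙_{q,n+1} = [δ_{j,k+1}·I_q]`, embedding `ℂ^{(n+1)q}` into the last `n+1` block
components of `ℂ^{(n+2)q}` (defined here with `n+1` block columns). -/
def embW (q n : ℕ) : Matrix (Fin (n + 1) × Fin q) (Fin n × Fin q) ℂ :=
  Matrix.of fun j k => if j.1.val = k.1.val + 1 ∧ j.2 = k.2 then (1 : ℂ) else 0

end


lemma mp_exists {m : Type*} [Fintype m] [DecidableEq m] {A : Matrix m m ℂ} (hA : A.IsHermitian) :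
    ∃ X : Matrix m m ℂ,
      A * X * A = A ∧ X * A * X = X ∧ (A * X)ᴴ = A * X ∧ (X * A)ᴴ = X * A := by
  have key : ∃ (U D : Matrix m m ℂ) (d : m → ℝ), Uᴴ * U = 1 ∧ D = Matrix.diagonal (fun i => (d i : ℂ)) ∧
      A = U * D * Uᴴ := by
    refine ⟨hA.eigenvectorUnitary, _, hA.eigenvalues, ?_, rfl, ?_⟩
    · exact Unitary.coe_star_mul_self hA.eigenvectorUnitary
    · have := hA.spectral_theorem
      rw [Unitary.conjStarAlgAut_apply] at this
      exact this
  obtain ⟨U, D, d, hU, hD, h⟩ := key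
  set E : Matrix m m ℂ := Matrix.diagonal (fun i => ((d i : ℂ))⁻¹) with hE
  have e (P Q : Matrix m m ℂ) : U * P * Uᴴ * (U * Q * Uᴴ) = U * (P * Q) * Uᴴ := by
    calc _ = U * P * (Uᴴ * U) * Q * Uᴴ := by simp only [Matrix.mul_assoc]
      _ = _ := by rw [hU]; simp only [Matrix.mul_assoc, Matrix.mul_one]; 
  have h1 : D * E * D = D := by
    rw [hD, hE, Matrix.diagonal_mul_diagonal, Matrix.diagonal_mul_diagonal]
    congr 1; ext i; by_cases hd : (d i : ℂ) = 0 <;> simp [hd]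
  have h2 : E * D * E = E := by
    rw [hD, hE, Matrix.diagonal_mul_diagonal, Matrix.diagonal_mul_diagonal]
    congr 1; ext i; by_cases hd : (d i : ℂ) = 0 <;> simp [hd]
  have h3 : (D * E)ᴴ = D * E := by
    rw [hD, hE, Matrix.diagonal_mul_diagonal, Matrix.diagonal_conjTranspose]
    congr 1; ext i; simp
  have h4 : (E * D)ᴴ = E * D := by
    rw [hD, hE, Matrix.diagonal_mul_diagonal, Matrix.diagonal_conjTranspose]
    congr 1; ext i; simp
  have c (P : Matrix m m ℂ) (hP : Pᴴ = P) : (U * P * Uᴴ)ᴴ = U * P * Uᴴ := by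
    simp only [Matrix.conjTranspose_mul, Matrix.conjTranspose_conjTranspose, hP, Matrix.mul_assoc]
  refine ⟨U * E * Uᴴ, ?_, ?_, ?_, ?_⟩
  · rw [h, e, e, h1]
  · rw [h, e, e, h2]
  · rw [h, e, c _ h3]
  · rw [h, e, c _ h4]

lemma mp_spec {m : Type*} [Fintype m] [DecidableEq m] {A : Matrix m m ℂ} (hA : A.IsHermitian) :
    A * mp A * A = A := by
  have h := mp_exists hA
  unfold mp
  rw [dif_pos h]
  exact h.choose_spec.1

lemma herm_move {m : Type*} [Fintype m] {A : Matrix m m ℂ} (hA : A.IsHermitian)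
    (u w : m → ℂ) (hw : A *ᵥ w = 0) : star w ⬝ᵥ (A *ᵥ u) = 0 := by
  have : star w ᵥ* A = 0 := by
    have := Matrix.star_mulVec A w
    rw [hw, hA.eq] at this
    simpa using this.symm
  rw [Matrix.dotProduct_mulVec, this, zero_dotProduct]

lemma herm_decomp {m : Type*} [Fintype m] [DecidableEq m] {A : Matrix m m ℂ}
    (hA : A.IsHermitian) (v : m → ℂ) : ∃ u w, v = A *ᵥ u + w ∧ A *ᵥ w = 0 := by
  obtain ⟨X, h1, -, h3, -⟩ := mp_exists hA
  refine ⟨X *ᵥ v, v - A *ᵥ (X *ᵥ v), by abel, ?_⟩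
  have : A * (A * X) = A := by
    have := congrArg conjTranspose h1
    rwa [Matrix.conjTranspose_mul, h3, hA.eq] at this
  rw [Matrix.mulVec_sub, Matrix.mulVec_mulVec, Matrix.mulVec_mulVec, Matrix.mul_assoc] at *
  rw [this, sub_self]

lemma herm_inter {m : Type*} [Fintype m] {A : Matrix m m ℂ}
    (hA : A.IsHermitian) (u : m → ℂ) (h : A *ᵥ (A *ᵥ u) = 0) : A *ᵥ u = 0 := by
  have := herm_move hA u (A *ᵥ u) h
  exact dotProduct_star_self_eq_zero.1 this

lemma range_of_ker {m : Type*} [Fintype m] [DecidableEq m] {A B : Matrix m m ℂ}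
    (hA : A.IsHermitian) (hB : B.IsHermitian) (h : ∀ k, B *ᵥ k = 0 → A *ᵥ k = 0) (w : m → ℂ) :
    ∃ u, B *ᵥ u = A *ᵥ w := by
  obtain ⟨u, r, e, hr⟩ := herm_decomp hB (A *ᵥ w)
  have h1 := herm_move hA w r (h r hr)
  have h2 := herm_move hB u r hr
  rw [e, dotProduct_add, h2, zero_add] at h1
  have : r = 0 := dotProduct_star_self_eq_zero.1 h1
  exact ⟨u, by rw [e, this, add_zero]⟩

/-- truncation of a sequence of vectors -/
def vecN {q : ℕ} (n : ℕ) (x : ℕ → Fin q → ℂ) : Fin (n + 1) × Fin q → ℂ := fun p => x p.1.val p.2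

def extN {q : ℕ} (n : ℕ) (v : Fin (n + 1) × Fin q → ℂ) : ℕ → Fin q → ℂ :=
  fun j b => if h : j < n + 1 then v (⟨j, h⟩, b) else 0

lemma vecN_extN {q n : ℕ} (v : Fin (n + 1) × Fin q → ℂ) : vecN n (extN n v) = v := by
  ext ⟨i, a⟩
  simp only [vecN, extN, i.isLt, dif_pos]

lemma sum_vec {q n : ℕ} (f : ℕ → Matrix (Fin q) (Fin q) ℂ) (x : ℕ → Fin q → ℂ) (a : Fin q) :
    (∑ p : Fin (n + 1) × Fin q, f p.1.val a p.2 * x p.1.val p.2) =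
      (∑ k ∈ Finset.range (n + 1), f k *ᵥ x k) a := by
  rw [Fintype.sum_prod_type, Finset.sum_apply, Finset.sum_range]
  rfl

lemma hank_vec {q n : ℕ} (s : ℕ → Matrix (Fin q) (Fin q) ℂ) (x : ℕ → Fin q → ℂ) :
    hank q n s *ᵥ vecN n x =
      vecN n (fun i => ∑ k ∈ Finset.range (n + 1), s (i + k) *ᵥ x k) := by
  ext ⟨i, a⟩
  exact sum_vec (fun k => s (i.val + k)) x a

lemma vecN_eq_zero {q n : ℕ} {x : ℕ → Fin q → ℂ} : vecN n x = 0 ↔ ∀ i ≤ n, x i = 0 := by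
  constructor
  · intro h i hi
    ext a
    exact congrFun h (⟨i, by omega⟩, a)
  · intro h
    ext ⟨i, a⟩
    exact congrFun (h i.val (by omega)) a

/-- kernel predicate -/
def KerH {q : ℕ} (n : ℕ) (s : ℕ → Matrix (Fin q) (Fin q) ℂ) (x : ℕ → Fin q → ℂ) : Prop :=
  ∀ i ≤ n, ∑ k ∈ Finset.range (n + 1), s (i + k) *ᵥ x k = 0

lemma KerH_iff {q n : ℕ} (s : ℕ → Matrix (Fin q) (Fin q) ℂ) (x : ℕ → Fin q → ℂ) :
    KerH n s x ↔ hank q n s *ᵥ vecN n x = 0 := by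
  rw [hank_vec, vecN_eq_zero]; rfl

lemma hank_mono {q n m : ℕ} (h : m ≤ n) {s : ℕ → Matrix (Fin q) (Fin q) ℂ}
    (hs : (hank q n s).PosSemidef) : (hank q m s).PosSemidef := by
  have := hs.submatrix (fun p : Fin (m + 1) × Fin q => (⟨p.1.val, by omega⟩, p.2))
  exact this

lemma KerH_ext {q n : ℕ} {s : ℕ → Matrix (Fin q) (Fin q) ℂ}
    (hs : (hank q (n + 1) s).PosSemidef) {x : ℕ → Fin q → ℂ} (hx : KerH n s x) :
    ∀ i ≤ n + 1, ∑ k ∈ Finset.range (n + 1), s (i + k) *ᵥ x k = 0 := by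
  set x' : ℕ → Fin q → ℂ := fun j => if j ≤ n then x j else 0 with hx'
  have e (i : ℕ) : ∑ k ∈ Finset.range (n + 1 + 1), s (i + k) *ᵥ x' k =
      ∑ k ∈ Finset.range (n + 1), s (i + k) *ᵥ x k := by
    rw [Finset.sum_range_succ]
    have : x' (n + 1) = 0 := by simp [hx']
    rw [this, Matrix.mulVec_zero, add_zero]
    refine Finset.sum_congr rfl fun k hk => ?_
    have : x' k = x k := by
      have := Finset.mem_range.1 hk
      simp [hx']; omega
    rw [this]
  have h0 : star (vecN (n + 1) x') ⬝ᵥ (hank q (n + 1) s *ᵥ vecN (n + 1) x') = 0 := by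
    rw [hank_vec, dotProduct]
    refine Finset.sum_eq_zero fun p _ => ?_
    obtain ⟨i, a⟩ := p
    by_cases hi : i.val ≤ n
    · have := hx i.val hi
      simp only [vecN, e, this]; simp
    · simp [vecN, hx', hi]
  have h1 := (hs.dotProduct_mulVec_zero_iff _).1 h0
  rw [hank_vec, vecN_eq_zero] at h1
  intro i hi
  rw [← e]; exact h1 i hi

def zM {q : ℕ} (n : ℕ) (s : ℕ → Matrix (Fin q) (Fin q) ℂ) : Matrix (Fin q) (Fin (n + 1) × Fin q) ℂ :=
  Matrix.of fun (a : Fin q) (j : Fin (n + 1) × Fin q) => s ((n + 1) + j.1.val) a j.2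

def yM {q : ℕ} (n : ℕ) (s : ℕ → Matrix (Fin q) (Fin q) ℂ) : Matrix (Fin (n + 1) × Fin q) (Fin q) ℂ :=
  Matrix.of fun (j : Fin (n + 1) × Fin q) (b : Fin q) => s ((n + 1) + j.1.val) j.2 b

lemma LS_succ (q n : ℕ) (s : ℕ → Matrix (Fin q) (Fin q) ℂ) :
    LS q s (n + 1) = s (2 * (n + 1)) - zM n s * mp (hank q n s) * yM n s := rfl

lemma zM_vec {q n : ℕ} (s : ℕ → Matrix (Fin q) (Fin q) ℂ) (x : ℕ → Fin q → ℂ) :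
    zM n s *ᵥ vecN n x = ∑ k ∈ Finset.range (n + 1), s (n + 1 + k) *ᵥ x k := by
  ext a
  exact sum_vec (fun k => s (n + 1 + k)) x a

lemma KerH_succ {q n : ℕ} (s : ℕ → Matrix (Fin q) (Fin q) ℂ) (x : ℕ → Fin q → ℂ) :
    KerH (n + 1) s x ↔ hank q n s *ᵥ vecN n x + yM n s *ᵥ x (n + 1) = 0 ∧
      zM n s *ᵥ vecN n x + s (2 * (n + 1)) *ᵥ x (n + 1) = 0 := by
  have hy : hank q n s *ᵥ vecN n x + yM n s *ᵥ x (n + 1) =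
      vecN n (fun i => ∑ k ∈ Finset.range (n + 1 + 1), s (i + k) *ᵥ x k) := by
    rw [hank_vec]
    ext ⟨i, a⟩
    simp only [vecN, Finset.sum_range_succ _ (n + 1), Pi.add_apply]
    congr 1
    rw [add_comm i.val (n + 1)]
    rfl
  rw [hy, vecN_eq_zero, zM_vec]
  have : s (2 * (n + 1)) = s (n + 1 + (n + 1)) := by congr 1; ring
  rw [this, ← Finset.sum_range_succ (fun k => s (n + 1 + k) *ᵥ x k)]
  constructor
  · intro h
    exact ⟨fun i hi => h i (by omega), h (n + 1) le_rfl⟩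
  · rintro ⟨h1, h2⟩ i hi
    rcases Nat.lt_or_ge n i with h | h
    · obtain rfl : i = n + 1 := by omega
      exact h2
    · exact h1 i h

lemma s_herm {q n : ℕ} {s : ℕ → Matrix (Fin q) (Fin q) ℂ}
    (hs : (hank q n s).PosSemidef) (i j : ℕ) (hi : i ≤ n) (hj : j ≤ n) : (s (i + j))ᴴ = s (i + j) := by
  ext a b
  have := hs.isHermitian.apply (⟨j, by omega⟩, a) (⟨i, by omega⟩, b)
  simp only [hank, Matrix.of_apply] at this
  rw [add_comm j i] at this
  simpa [Matrix.conjTranspose_apply] using this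

lemma yM_eq {q n : ℕ} {s : ℕ → Matrix (Fin q) (Fin q) ℂ} (hs : (hank q (n + 1) s).PosSemidef) :
    yM n s = (zM n s)ᴴ := by
  ext ⟨i, a⟩ b
  have := s_herm hs (n + 1) i.val le_rfl (by omega)
  have := congrFun (congrFun this a) b
  simpa [yM, zM] using this.symm

lemma zM_eq {q n : ℕ} {s : ℕ → Matrix (Fin q) (Fin q) ℂ} (hs : (hank q (n + 1) s).PosSemidef) :
    zM n s * mp (hank q n s) * hank q n s = zM n s := by
  have hH := mp_spec (hank_mono (Nat.le_succ n) hs).isHermitian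
  have : zM n s * (1 - mp (hank q n s) * hank q n s) = 0 := by
    apply Matrix.ext_of_mulVec_single
    intro p
    rw [Matrix.zero_mulVec, ← Matrix.mulVec_mulVec]
    set v := (1 - mp (hank q n s) * hank q n s) *ᵥ Pi.single p 1 with hv
    have hk : hank q n s *ᵥ v = 0 := by
      rw [hv, Matrix.mulVec_mulVec, Matrix.mul_sub, ← Matrix.mul_assoc, hH, Matrix.mul_one, sub_self,
        Matrix.zero_mulVec]
    rw [← vecN_extN v] at hk ⊢
    rw [zM_vec]
    exact KerH_ext hs ((KerH_iff _ _).2 hk) (n + 1) le_rfl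
  rw [Matrix.mul_sub, Matrix.mul_one, sub_eq_zero, ← Matrix.mul_assoc] at this
  exact this.symm

lemma yM_eq' {q n : ℕ} {s : ℕ → Matrix (Fin q) (Fin q) ℂ} (hs : (hank q (n + 1) s).PosSemidef) :
    yM n s = hank q n s * (mp (hank q n s))ᴴ * yM n s := by
  have h := congrArg conjTranspose (zM_eq hs)
  rw [Matrix.conjTranspose_mul, Matrix.conjTranspose_mul,
    (hank_mono (Nat.le_succ n) hs).isHermitian.eq, ← yM_eq hs, ← Matrix.mul_assoc] at h
  exact h.symm

lemma yM_eq2 {q n : ℕ} {s : ℕ → Matrix (Fin q) (Fin q) ℂ} (hs : (hank q (n + 1) s).PosSemidef) :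
    hank q n s * mp (hank q n s) * yM n s = yM n s := by
  have hH := mp_spec (hank_mono (Nat.le_succ n) hs).isHermitian
  rw [yM_eq' hs]
  simp only [← Matrix.mul_assoc]
  rw [hH]

lemma LS_herm {q n : ℕ} {s : ℕ → Matrix (Fin q) (Fin q) ℂ} (hs : (hank q n s).PosSemidef) :
    (LS q s n).IsHermitian := by
  cases n with
  | zero => exact s_herm hs 0 0 le_rfl le_rfl
  | succ n =>
    have e : zM n s * mp (hank q n s) * yM n s =
        zM n s * mp (hank q n s) * hank q n s * (zM n s * mp (hank q n s))ᴴ := by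
      conv_lhs => rw [yM_eq' hs]
      rw [Matrix.conjTranspose_mul, ← yM_eq hs]
      simp only [Matrix.mul_assoc]
    rw [LS_succ]
    refine Matrix.IsHermitian.sub ?_ ?_
    · have := s_herm hs (n + 1) (n + 1) le_rfl le_rfl
      rw [two_mul]; exact this
    · rw [e]
      exact Matrix.isHermitian_mul_mul_conjTranspose _ (hank_mono (Nat.le_succ n) hs).isHermitian

lemma ker_of_KerH {q n : ℕ} {s : ℕ → Matrix (Fin q) (Fin q) ℂ} (hs : (hank q n s).PosSemidef)
    {x : ℕ → Fin q → ℂ} (hx : KerH n s x) : LS q s n *ᵥ x n = 0 := by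
  cases n with
  | zero => simpa [LS] using hx 0 le_rfl
  | succ n =>
    obtain ⟨h1, h2⟩ := (KerH_succ _ _).1 hx
    rw [← zM_eq hs, ← Matrix.mulVec_mulVec, eq_neg_of_add_eq_zero_left h1, Matrix.mulVec_neg,
      Matrix.mulVec_mulVec] at h2
    rw [LS_succ, Matrix.sub_mulVec, ← h2]; abel

lemma KerH_of_ker {q n : ℕ} {s : ℕ → Matrix (Fin q) (Fin q) ℂ} (hs : (hank q n s).PosSemidef)
    {k : Fin q → ℂ} (hk : LS q s n *ᵥ k = 0) : ∃ x, KerH n s x ∧ x n = k := by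
  cases n with
  | zero =>
    refine ⟨fun _ => k, ?_, rfl⟩
    intro i hi
    obtain rfl : i = 0 := by omega
    simpa [LS] using hk
  | succ n =>
    set v := -((mp (hank q n s) * yM n s) *ᵥ k) with hv
    have e : vecN n (fun j => if j ≤ n then extN n v j else k) = v := by
      ext ⟨i, a⟩
      have : i.val ≤ n := by omega
      simp [vecN, extN, this]
    refine ⟨fun j => if j ≤ n then extN n v j else k, ?_, by simp⟩
    rw [KerH_succ, e]
    simp only [hv, Matrix.mulVec_neg, Matrix.mulVec_mulVec, ← Matrix.mul_assoc, yM_eq2 hs]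
    have : ¬ (n + 1 ≤ n) := by omega
    simp only [this, if_false]
    refine ⟨by abel, ?_⟩
    rw [LS_succ, Matrix.sub_mulVec] at hk
    rw [← hk]; abel

lemma LS_shift_le {q n : ℕ} {s : ℕ → Matrix (Fin q) (Fin q) ℂ} {α : ℝ}
    (hs : (hank q (n + 1) s).PosSemidef) (ha : (hank q n (sShift α s)).PosSemidef) (w : Fin q → ℂ) :
    ∃ u, LS q s n *ᵥ u = LS q (sShift α s) n *ᵥ w := by
  have hs' := hank_mono (Nat.le_succ n) hs
  refine range_of_ker (LS_herm ha) (LS_herm hs') (fun k hk => ?_) w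
  obtain ⟨x, hx, rfl⟩ := KerH_of_ker hs' hk
  apply ker_of_KerH ha
  intro i hi
  have h1 := KerH_ext hs hx i (by omega)
  have h2 := KerH_ext hs hx (i + 1) (by omega)
  simp only [sShift, Matrix.add_mulVec, Matrix.smul_mulVec, Finset.sum_add_distrib,
    ← Finset.smul_sum, h1, smul_zero, zero_add]
  rw [← h2]
  refine Finset.sum_congr rfl fun k _ => ?_
  rw [add_right_comm]

lemma LS_le_shift {q n : ℕ} {s : ℕ → Matrix (Fin q) (Fin q) ℂ} {α : ℝ}
    (hs : (hank q (n + 1) s).PosSemidef) (ha : (hank q (n + 1) (sShift α s)).PosSemidef)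
    (w : Fin q → ℂ) :
    ∃ u, LS q (sShift α s) n *ᵥ u = LS q s (n + 1) *ᵥ w := by
  have ha' := hank_mono (Nat.le_succ n) ha
  refine range_of_ker (LS_herm hs) (LS_herm ha') (fun k hk => ?_) w
  obtain ⟨x, hx, rfl⟩ := KerH_of_ker ha' hk
  set y : ℕ → Fin q → ℂ := fun j => (if j = 0 then 0 else x (j - 1)) +
    (if j ≤ n then (-(α : ℂ)) • x j else 0) with hy
  have : x n = y (n + 1) := by simp [hy]
  rw [this]
  apply ker_of_KerH hs
  intro i hi
  rw [← KerH_ext ha hx i hi]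
  simp only [hy, sShift, Matrix.mulVec_add, Finset.sum_add_distrib, Matrix.add_mulVec]
  rw [Finset.sum_range_succ', Finset.sum_range_succ (fun k => s (i + k) *ᵥ
    (if k ≤ n then (-(α : ℂ)) • x k else 0)), add_comm]
  congr 1
  · have : ¬ (n + 1 ≤ n) := by omega
    simp only [this, if_false, Matrix.mulVec_zero, add_zero]
    refine Finset.sum_congr rfl fun k hk => ?_
    have : k ≤ n := by have := Finset.mem_range.1 hk; omega
    rw [if_pos this, Matrix.mulVec_smul, Matrix.smul_mulVec]
  · simp [add_assoc]

lemma Ldiag_vec {q n : ℕ} (s : ℕ → Matrix (Fin q) (Fin q) ℂ) (x : ℕ → Fin q → ℂ) :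
    Ldiag q n s *ᵥ vecN n x = vecN n (fun i => LS q s i *ᵥ x i) := by
  ext ⟨i, a⟩
  simp only [Ldiag, Matrix.mulVec, dotProduct, Fintype.sum_prod_type, Matrix.of_apply, vecN]
  rw [Finset.sum_eq_single i]
  · simp
  · intro b _ hb
    simp [hb.symm]
  · simp

lemma mem_Dsub {q n : ℕ} (s : ℕ → Matrix (Fin q) (Fin q) ℂ) (x : ℕ → Fin q → ℂ) :
    vecN n x ∈ Dsub q n s ↔ ∀ i ≤ n, ∃ w, LS q s i *ᵥ w = x i := by
  constructor
  · rintro ⟨v, hv⟩ i hi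
    rw [← vecN_extN v, Matrix.mulVecLin_apply, Ldiag_vec] at hv
    refine ⟨extN n v i, ?_⟩
    ext a
    exact congrFun hv (⟨i, by omega⟩, a)
  · intro h
    have : ∀ i, ∃ w, i ≤ n → LS q s i *ᵥ w = x i := by
      intro i
      by_cases hi : i ≤ n
      · obtain ⟨w, hw⟩ := h i hi
        exact ⟨w, fun _ => hw⟩
      · exact ⟨0, fun h => absurd h hi⟩
    choose w hw using this
    refine ⟨vecN n w, ?_⟩
    rw [Matrix.mulVecLin_apply, Ldiag_vec]
    ext ⟨i, a⟩
    exact congrFun (hw i.val (by omega)) a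

lemma inter_aux {q n : ℕ} {s : ℕ → Matrix (Fin q) (Fin q) ℂ} (hs : (hank q n s).PosSemidef)
    (x : ℕ → Fin q → ℂ) (hx : KerH n s x) (hd : ∀ i ≤ n, ∃ w, LS q s i *ᵥ w = x i) :
    ∀ i ≤ n, x i = 0 := by
  induction n with
  | zero =>
    intro i hi
    obtain rfl : i = 0 := by omega
    obtain ⟨w, hw⟩ := hd 0 le_rfl
    have := ker_of_KerH hs hx
    rw [← hw] at this ⊢
    exact herm_inter (LS_herm hs) _ this
  | succ n ih =>
    have h0 : x (n + 1) = 0 := by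
      obtain ⟨w, hw⟩ := hd (n + 1) le_rfl
      have := ker_of_KerH hs hx
      rw [← hw] at this ⊢
      exact herm_inter (LS_herm hs) _ this
    have hx' : KerH n s x := by
      intro i hi
      have := hx i (by omega)
      rwa [Finset.sum_range_succ, h0, Matrix.mulVec_zero, add_zero] at this
    have := ih (hank_mono (Nat.le_succ n) hs) hx' (fun i hi => hd i (by omega))
    intro i hi
    rcases Nat.lt_or_ge n i with h | h
    · obtain rfl : i = n + 1 := by omega
      exact h0
    · exact this i h

lemma sup_aux {q n : ℕ} {s : ℕ → Matrix (Fin q) (Fin q) ℂ} (hs : (hank q n s).PosSemidef)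
    (x : ℕ → Fin q → ℂ) : ∃ k d : ℕ → Fin q → ℂ, KerH n s k ∧ (∀ i ≤ n, ∃ w, LS q s i *ᵥ w = d i) ∧
      ∀ i ≤ n, x i = k i + d i := by
  induction n generalizing x with
  | zero =>
    obtain ⟨u, w, h1, h2⟩ := herm_decomp (LS_herm hs) (x 0)
    obtain ⟨k, hk, rfl⟩ := KerH_of_ker hs h2
    refine ⟨k, fun _ => LS q s 0 *ᵥ u, hk, ?_, ?_⟩
    · intro i hi
      obtain rfl : i = 0 := by omega
      exact ⟨u, rfl⟩
    · intro i hi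
      obtain rfl : i = 0 := by omega
      rw [h1, add_comm]
  | succ n ih =>
    obtain ⟨u, w, h1, h2⟩ := herm_decomp (LS_herm hs) (x (n + 1))
    obtain ⟨k, hk, rfl⟩ := KerH_of_ker hs h2
    obtain ⟨k', d', hk', hd', e⟩ := ih (hank_mono (Nat.le_succ n) hs) (fun i => x i - k i)
    refine ⟨fun i => k i + if i ≤ n then k' i else 0,
      fun i => if i ≤ n then d' i else LS q s (n + 1) *ᵥ u, ?_, ?_, ?_⟩
    · intro i hi
      simp only [Matrix.mulVec_add, Finset.sum_add_distrib]
      rw [hk i hi, zero_add, Finset.sum_range_succ]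
      refine Eq.trans ?_ (KerH_ext hs hk' i hi)
      have : ¬ (n + 1 ≤ n) := by omega
      simp only [this, if_false, Matrix.mulVec_zero, add_zero]
      refine Finset.sum_congr rfl fun k hk => ?_
      have : k ≤ n := by have := Finset.mem_range.1 hk; omega
      rw [if_pos this]
    · intro i hi
      rcases Nat.lt_or_ge n i with h | h
      · obtain rfl : i = n + 1 := by omega
        exact ⟨u, by simp⟩
      · simpa only [if_pos h] using hd' i h
    · intro i hi
      rcases Nat.lt_or_ge n i with h | h
      · obtain rfl : i = n + 1 := by omega
        simp [h1, add_comm]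
      · simp only [if_pos h]
        have := e i h
        rw [add_assoc, ← this]; abel

lemma inter_bot {q n : ℕ} {s : ℕ → Matrix (Fin q) (Fin q) ℂ} (hs : (hank q n s).PosSemidef) :
    LinearMap.ker (Matrix.mulVecLin (hank q n s)) ⊓ Dsub q n s = ⊥ := by
  rw [eq_bot_iff]
  rintro v ⟨h1, h2⟩
  rw [← vecN_extN v] at h1 h2 ⊢
  exact vecN_eq_zero.2 (inter_aux hs _ ((KerH_iff _ _).2 h1) ((mem_Dsub _ _).1 h2))

lemma sup_top {q n : ℕ} {s : ℕ → Matrix (Fin q) (Fin q) ℂ} (hs : (hank q n s).PosSemidef) :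
    LinearMap.ker (Matrix.mulVecLin (hank q n s)) ⊔ Dsub q n s = ⊤ := by
  rw [eq_top_iff]
  rintro v -
  obtain ⟨k, d, h1, h2, h3⟩ := sup_aux hs (extN n v)
  refine Submodule.mem_sup.2 ⟨vecN n k, (KerH_iff _ _).1 h1, vecN n d, (mem_Dsub _ _).2 h2, ?_⟩
  rw [← vecN_extN v]
  ext ⟨i, a⟩
  exact (congrFun (h3 i.val (by omega)) a).symm

lemma hank_congr {q n : ℕ} {s t : ℕ → Matrix (Fin q) (Fin q) ℂ} (h : ∀ j ≤ 2 * n, t j = s j) :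
    hank q n t = hank q n s := by
  ext ⟨i, a⟩ ⟨j, b⟩
  simp only [hank, Matrix.of_apply]
  rw [h _ (by omega)]

lemma LS_congr {q n : ℕ} {s t : ℕ → Matrix (Fin q) (Fin q) ℂ} (h : ∀ j ≤ 2 * n, t j = s j) :
    LS q t n = LS q s n := by
  cases n with
  | zero => exact h 0 (by omega)
  | succ n =>
    have hz : zM n t = zM n s := by
      ext a ⟨j, b⟩
      simp only [zM, Matrix.of_apply]
      rw [h _ (by omega)]
    have hy : yM n t = yM n s := by
      ext ⟨j, b⟩ a
      simp only [yM, Matrix.of_apply]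
      rw [h _ (by omega)]
    rw [LS_succ, LS_succ, hz, hy, hank_congr (fun j hj => h j (by omega)), h _ le_rfl]

lemma Dsub_congr {q n : ℕ} {s t : ℕ → Matrix (Fin q) (Fin q) ℂ} (h : ∀ j ≤ 2 * n, t j = s j) :
    Dsub q n t = Dsub q n s := by
  have : Ldiag q n t = Ldiag q n s := by
    ext ⟨i, a⟩ ⟨j, b⟩
    simp only [Ldiag, Matrix.of_apply]
    rw [LS_congr (n := i.val) (fun j hj => h j (by omega))]
  rw [Dsub, Dsub, this]

lemma sShift_congr {q n : ℕ} {α : ℝ} {s t : ℕ → Matrix (Fin q) (Fin q) ℂ}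
    (h : ∀ j ≤ 2 * n + 1, t j = s j) : ∀ j ≤ 2 * n, sShift α t j = sShift α s j := by
  intro j hj
  simp only [sShift]
  rw [h _ (by omega), h _ (by omega)]

lemma bshift_vec {q n : ℕ} (x : ℕ → Fin q → ℂ) :
    (bshift q n)ᴴ *ᵥ vecN n x = vecN n (fun i => if i < n then x (i + 1) else 0) := by
  ext ⟨i, a⟩
  simp only [Matrix.mulVec, dotProduct, Fintype.sum_prod_type, Matrix.conjTranspose_apply, bshift,
    Matrix.of_apply, vecN]
  by_cases hi : i.val < n
  · rw [Finset.sum_eq_single ⟨i.val + 1, by omega⟩, Finset.sum_eq_single a]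
    · simp [hi]
    · intro b _ hb; simp [hb]
    · simp
    · intro b _ hb
      have : ¬ (b.val = i.val + 1) := fun h => hb (Fin.ext h)
      simp [this]
    · simp
  · simp only [hi, if_false, Pi.zero_apply]
    refine Finset.sum_eq_zero fun b _ => Finset.sum_eq_zero fun c _ => ?_
    have : ¬ (b.val = i.val + 1) := by omega
    simp [this]

lemma embW_vec {q n : ℕ} (x : ℕ → Fin q → ℂ) :
    (embW q (n + 1))ᴴ *ᵥ vecN (n + 1) x = vecN n (fun i => x (i + 1)) := by
  ext ⟨i, a⟩
  simp only [Matrix.mulVec, dotProduct, Fintype.sum_prod_type, Matrix.conjTranspose_apply, embW,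
    Matrix.of_apply, vecN]
  rw [Finset.sum_eq_single ⟨i.val + 1, by omega⟩, Finset.sum_eq_single a]
  · simp
  · intro b _ hb; simp [hb]
  · simp
  · intro b _ hb
    have : ¬ (b.val = i.val + 1) := fun h => hb (Fin.ext h)
    simp [this]
  · simp

lemma embV_vec {q n : ℕ} (x : ℕ → Fin q → ℂ) :
    (embV q (n + 1)) *ᵥ vecN n x = vecN (n + 1) (fun i => if i ≤ n then x i else 0) := by
  ext ⟨i, a⟩
  simp only [Matrix.mulVec, dotProduct, Fintype.sum_prod_type, embV, Matrix.of_apply, vecN]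
  by_cases hi : i.val ≤ n
  · rw [Finset.sum_eq_single ⟨i.val, by omega⟩, Finset.sum_eq_single a]
    · simp [hi]
    · intro b _ hb; simp [hb.symm]
    · simp
    · intro b _ hb
      have : ¬ (i.val = b.val) := fun h => hb (Fin.ext h.symm)
      simp [this]
    · simp
  · simp only [hi, if_false, Pi.zero_apply]
    refine Finset.sum_eq_zero fun b _ => Finset.sum_eq_zero fun c _ => ?_
    have : ¬ (i.val = b.val) := by omega
    simp [this]

/-- Proposition (DU): for α-Stieltjes nonnegative definite extendable sequences, inclusion
relations between the canonical subspaces `D_n`, `D_{α▷n}` and the corresponding direct sum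
decompositions with the kernels of `H_n` and `H_{α▷n}`.  Part (b) is stated with `n+1` in
place of the positive integer `n`. -/
theorem dubovoj_subspaces_of_stieltjes_sequences (q : ℕ) (hq : 1 ≤ q) (α : ℝ) :
    (∀ (n : ℕ) (s : ℕ → Matrix (Fin q) (Fin q) ℂ),
      (∃ t : ℕ → Matrix (Fin q) (Fin q) ℂ,
        (∀ j ≤ 2 * n + 1, t j = s j) ∧
          (hank q (n + 1) t).PosSemidef ∧ (hank q n (sShift α t)).PosSemidef) →
      Submodule.map (Matrix.mulVecLin (bshift q n)ᴴ) (Dsub q n s) ≤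
          Dsub q n (sShift α s) ∧
      Dsub q n (sShift α s) ≤ Dsub q n s ∧
      LinearMap.ker (Matrix.mulVecLin (hank q n s)) ⊓ Dsub q n s = ⊥ ∧
      LinearMap.ker (Matrix.mulVecLin (hank q n s)) ⊔ Dsub q n s = ⊤ ∧
      LinearMap.ker (Matrix.mulVecLin (hank q n (sShift α s))) ⊓ Dsub q n (sShift α s) = ⊥ ∧
      LinearMap.ker (Matrix.mulVecLin (hank q n (sShift α s))) ⊔ Dsub q n (sShift α s) = ⊤) ∧
    (∀ (n : ℕ) (s : ℕ → Matrix (Fin q) (Fin q) ℂ),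
      (∃ t : ℕ → Matrix (Fin q) (Fin q) ℂ,
        (∀ j ≤ 2 * (n + 1), t j = s j) ∧
          (hank q (n + 1) t).PosSemidef ∧ (hank q (n + 1) (sShift α t)).PosSemidef) →
      Submodule.map (Matrix.mulVecLin (embW q (n + 1))ᴴ) (Dsub q (n + 1) s) ≤
          Dsub q n (sShift α s) ∧
      Submodule.map (Matrix.mulVecLin (embV q (n + 1))) (Dsub q n (sShift α s)) ≤
          Dsub q (n + 1) s ∧
      LinearMap.ker (Matrix.mulVecLin (hank q (n + 1) s)) ⊓ Dsub q (n + 1) s = ⊥ ∧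
      LinearMap.ker (Matrix.mulVecLin (hank q (n + 1) s)) ⊔ Dsub q (n + 1) s = ⊤ ∧
      LinearMap.ker (Matrix.mulVecLin (hank q n (sShift α s))) ⊓ Dsub q n (sShift α s) = ⊥ ∧
      LinearMap.ker (Matrix.mulVecLin (hank q n (sShift α s))) ⊔ Dsub q n (sShift α s) = ⊤) := by
  constructor
  · rintro n s ⟨t, hts, h1, h2⟩
    have c1 : ∀ j ≤ 2 * n, t j = s j := fun j hj => hts j (by omega)
    have c2 := sShift_congr (α := α) hts
    rw [← Dsub_congr c1, ← Dsub_congr c2, ← hank_congr c1, ← hank_congr c2]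
    have h1' := hank_mono (Nat.le_succ n) h1
    refine ⟨?_, ?_, inter_bot h1', sup_top h1', inter_bot h2, sup_top h2⟩
    · rintro _ ⟨v, hv, rfl⟩
      rw [← vecN_extN v] at hv ⊢
      rw [Matrix.mulVecLin_apply, bshift_vec, mem_Dsub]
      intro i hi
      by_cases h : i < n
      · obtain ⟨w, hw⟩ := (mem_Dsub _ _).1 hv (i + 1) (by omega)
        simp only [h, if_true]
        rw [← hw]
        exact LS_le_shift (hank_mono (by omega) h1) (hank_mono (by omega) h2) w
      · exact ⟨0, by simp [h]⟩
    · intro v hv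
      rw [← vecN_extN v] at hv ⊢
      rw [mem_Dsub] at hv ⊢
      intro i hi
      obtain ⟨w, hw⟩ := hv i hi
      rw [← hw]
      exact LS_shift_le (hank_mono (by omega) h1) (hank_mono (by omega) h2) w
  · rintro n s ⟨t, hts, h1, h2⟩
    have c2 : ∀ j ≤ 2 * n, sShift α t j = sShift α s j :=
      sShift_congr (fun j hj => hts j (by omega))
    rw [← Dsub_congr hts, ← Dsub_congr c2, ← hank_congr hts, ← hank_congr c2]
    have h2' := hank_mono (Nat.le_succ n) h2
    refine ⟨?_, ?_, inter_bot h1, sup_top h1, inter_bot h2', sup_top h2'⟩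
    · rintro _ ⟨v, hv, rfl⟩
      rw [← vecN_extN v] at hv ⊢
      rw [Matrix.mulVecLin_apply, embW_vec, mem_Dsub]
      intro i hi
      obtain ⟨w, hw⟩ := (mem_Dsub _ _).1 hv (i + 1) (by omega)
      rw [← hw]
      exact LS_le_shift (hank_mono (by omega) h1) (hank_mono (by omega) h2) w
    · rintro _ ⟨v, hv, rfl⟩
      rw [← vecN_extN v] at hv ⊢
      rw [Matrix.mulVecLin_apply, embV_vec, mem_Dsub]
      intro i hi
      by_cases h : i ≤ n
      · obtain ⟨w, hw⟩ := (mem_Dsub _ _).1 hv i h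
        simp only [h, if_true]
        rw [← hw]
        exact LS_shift_le (hank_mono (by omega) h1) (hank_mono (by omega) h2) w
      · exact ⟨0, by simp [h]⟩
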